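/- Let {W(k); k∈ℤ₊} be a sequence of nonnegative square matrices of fixed finite dimension such that W := Σ_{k=0}^{∞} W(k) satisfies Σ_{n=0}^{∞} W^n = (I−W)^{−1} < ∞ (entrywise finite). Suppose there exists a ℤ₊-valued random variable U that is locally subexponential with span one such that lim_{k→∞} W(k)/P(U=k) = W̃ ≥ O entrywise. Then lim_{k→∞} (Σ_{n=0}^{∞} W^{*n}(k)) / P(U=k) = (I−W)^{−1} W̃ (I−W)^{−1}, where W^{*n} denotes the n-fold matrix convolution of the sequence {W(k)}. -/

import Mathlib

open Filter Topology

/-- Discrete convolution of two sequences on ℤ₊. -/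
noncomputable def conv (f g : ℕ → ℝ) (k : ℕ) : ℝ :=
  ∑ l ∈ Finset.range (k + 1), f (k - l) * g l

/-- `U ∈ S_loc(1)`: locally subexponential with span one. -/
def SLocOne (q : ℕ → ℝ) : Prop :=
  (∀ᶠ k in atTop, 0 < q k) ∧
    Tendsto (fun k => q (k + 1) / q k) atTop (nhds 1) ∧
    Tendsto (fun k => conv q q k / q k) atTop (nhds 2)

/-- `n`-fold convolution of a square-matrix sequence with itself;
`W^{*0}(0) = I`, `W^{*0}(k) = O` for `k ≥ 1`. -/
noncomputable def mconvPow {M : ℕ} (W : ℕ → Matrix (Fin M) (Fin M) ℝ) :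
    ℕ → ℕ → Matrix (Fin M) (Fin M) ℝ
  | 0 => fun k => if k = 0 then 1 else 0
  | n + 1 => fun k => ∑ l ∈ Finset.range (k + 1), mconvPow W n (k - l) * W l

/-- The part of the convolution `conv f g k` in which both indices are at least `A`. -/
noncomputable def midConv (A : ℕ) (f g : ℕ → ℝ) (k : ℕ) : ℝ :=
  ∑ l ∈ Finset.Ico A (k + 1 - A), f (k - l) * g l

theorem conv_eq_heads_add_midConv (f g : ℕ → ℝ) {A k : ℕ} (h : 2 * A ≤ k + 1) :
    conv f g k = ∑ l ∈ Finset.range A, f (k - l) * g l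
      + ∑ l ∈ Finset.range A, f l * g (k - l) + midConv A f g k := by
  have h1 : ∑ l ∈ Finset.range A, f l * g (k - l)
      = ∑ l ∈ Finset.Ico (k + 1 - A) (k + 1), f (k - l) * g l := by
    refine Finset.sum_bij' (fun l _ => k - l) (fun l _ => k - l) ?_ ?_ ?_ ?_ ?_
    · intro l hl
      simp only [Finset.mem_range, Finset.mem_Ico] at hl ⊢
      omega
    · intro l hl
      simp only [Finset.mem_range, Finset.mem_Ico] at hl ⊢
      omega
    · intro l hl
      simp only [Finset.mem_range] at hl
      omega
    · intro l hl
      simp only [Finset.mem_Ico] at hl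
      omega
    · intro l hl
      simp only [Finset.mem_range] at hl
      rw [show k - (k - l) = l by omega]
  rw [h1, midConv, conv, add_right_comm, Finset.sum_range_add_sum_Ico _ (by omega),
    Finset.sum_range_add_sum_Ico _ (by omega)]

theorem midConv_le_of_le {A : ℕ} {f g f' g' : ℕ → ℝ} (hg : ∀ k, 0 ≤ g k)
    (hf' : ∀ k, 0 ≤ f' k) (hf : ∀ k, A ≤ k → f k ≤ f' k) (hgg : ∀ k, A ≤ k → g k ≤ g' k)
    (k : ℕ) : midConv A f g k ≤ midConv A f' g' k := by
  refine Finset.sum_le_sum fun l hl => ?_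
  simp only [Finset.mem_Ico] at hl
  exact mul_le_mul (hf _ (by omega)) (hgg _ hl.1) (hg _) (hf' _)

theorem midConv_const_mul (A : ℕ) (f g : ℕ → ℝ) (a b : ℝ) (k : ℕ) :
    midConv A (fun k => a * f k) (fun k => b * g k) k = a * b * midConv A f g k := by
  simp only [midConv, Finset.mul_sum]
  exact Finset.sum_congr rfl fun l _ => by ring

theorem midConv_nonneg {f g : ℕ → ℝ} (hf : ∀ k, 0 ≤ f k) (hg : ∀ k, 0 ≤ g k) (A k : ℕ) :
    0 ≤ midConv A f g k :=
  Finset.sum_nonneg fun _ _ => mul_nonneg (hf _) (hg _)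

namespace SLocOne

variable {q : ℕ → ℝ}

theorem tendsto_sub_div (hq : SLocOne q) (l : ℕ) :
    Tendsto (fun k => q (k - l) / q k) atTop (𝓝 1) := by
  rw [← tendsto_add_atTop_iff_nat l]
  simp only [Nat.add_sub_cancel]
  induction l with
  | zero =>
    refine tendsto_const_nhds.congr' ?_
    filter_upwards [hq.1] with k hk
    simp [hk.ne']
  | succ l ih =>
    have h := ih.mul (((tendsto_add_atTop_iff_nat l).2 hq.2.1).inv₀ one_ne_zero)
    simp only [inv_one, mul_one] at h
    refine h.congr' ?_
    filter_upwards [(tendsto_add_atTop_nat l).eventually hq.1] with k hk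
    rw [inv_div, div_mul_div_cancel₀ hk.ne', add_assoc]

theorem tendsto_comp_sub_div (hq : SLocOne q) {f : ℕ → ℝ} {a : ℝ}
    (hf : Tendsto (fun k => f k / q k) atTop (𝓝 a)) (l : ℕ) :
    Tendsto (fun k => f (k - l) / q k) atTop (𝓝 a) := by
  have h := (hf.comp (tendsto_sub_atTop_nat l)).mul (hq.tendsto_sub_div l)
  rw [mul_one] at h
  refine h.congr' ?_
  filter_upwards [(tendsto_sub_atTop_nat l).eventually hq.1] with k hk
  simp only [Function.comp_apply]
  rw [div_mul_div_cancel₀ hk.ne']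

theorem tendsto_div_self (hq : SLocOne q) : Tendsto (fun k => q k / q k) atTop (𝓝 1) :=
  hq.tendsto_sub_div 0

theorem tendsto_head_div (hq : SLocOne q) {f : ℕ → ℝ} {a : ℝ}
    (hf : Tendsto (fun k => f k / q k) atTop (𝓝 a)) (g : ℕ → ℝ) (A : ℕ) :
    Tendsto (fun k => (∑ l ∈ Finset.range A, f (k - l) * g l) / q k) atTop
      (𝓝 (a * ∑ l ∈ Finset.range A, g l)) := by
  rw [Finset.mul_sum]
  refine (tendsto_finsetSum _ fun l _ =>
    (hq.tendsto_comp_sub_div hf l).mul_const (g l)).congr fun k => ?_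
  rw [Finset.sum_div]
  exact Finset.sum_congr rfl fun l _ => by ring

theorem tendsto_head_div' (hq : SLocOne q) {f : ℕ → ℝ} {a : ℝ}
    (hf : Tendsto (fun k => f k / q k) atTop (𝓝 a)) (g : ℕ → ℝ) (A : ℕ) :
    Tendsto (fun k => (∑ l ∈ Finset.range A, g l * f (k - l)) / q k) atTop
      (𝓝 (a * ∑ l ∈ Finset.range A, g l)) := by
  simpa only [mul_comm] using hq.tendsto_head_div hf g A

theorem tendsto_midConv_div (hq : SLocOne q) (A : ℕ) :
    Tendsto (fun k => midConv A q q k / q k) atTop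
      (𝓝 (2 - 2 * ∑ l ∈ Finset.range A, q l)) := by
  have h := (hq.2.2.sub (hq.tendsto_head_div hq.tendsto_div_self q A)).sub
    (hq.tendsto_head_div' hq.tendsto_div_self q A)
  rw [show (2 : ℝ) - 2 * ∑ l ∈ Finset.range A, q l
    = 2 - 1 * ∑ l ∈ Finset.range A, q l - 1 * ∑ l ∈ Finset.range A, q l by ring]
  refine h.congr' ?_
  filter_upwards [eventually_ge_atTop (2 * A)] with k hk
  rw [conv_eq_heads_add_midConv q q (show 2 * A ≤ k + 1 by omega)]
  ring

theorem eventually_le_of_tendsto_div (hq : SLocOne q) {f : ℕ → ℝ} {a b : ℝ}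
    (hf : Tendsto (fun k => f k / q k) atTop (𝓝 a)) (hab : a < b) :
    ∀ᶠ k in atTop, f k ≤ b * q k := by
  filter_upwards [hq.1, hf.eventually (gt_mem_nhds hab)] with k hk h
  exact ((div_lt_iff₀ hk).1 h).le

theorem eventually_mul_midConv_le (hq : SLocOne q) (hsum : HasSum q 1) (c : ℝ) {ε : ℝ}
    (hε : 0 < ε) : ∀ᶠ A in atTop, ∀ᶠ k in atTop, c * midConv A q q k ≤ ε * q k := by
  have h : Tendsto (fun A => c * (2 - 2 * ∑ l ∈ Finset.range A, q l)) atTop (𝓝 0) := by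
    simpa using ((hsum.tendsto_sum_nat.const_mul 2).const_sub 2).const_mul c
  filter_upwards [h.eventually (gt_mem_nhds hε)] with A hA
  refine hq.eventually_le_of_tendsto_div ?_ hA
  simpa only [mul_div_assoc] using (hq.tendsto_midConv_div A).const_mul c

end SLocOne

section Renewal

variable {ι : Type*} [Fintype ι] {q : ℕ → ℝ} {W : ι → ι → ℕ → ℝ} {w a : ι → ι → ℝ} {v : ι → ℝ}

/-- Solutions of a defective renewal recursion, started from zero, are dominated by the
locally subexponential sequence uniformly in the number of steps. -/
theorem exists_bound_of_renewal_iterates (hq : SLocOne q) (hqnn : ∀ k, 0 ≤ q k)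
    (hqsum : HasSum q 1) (hWnn : ∀ s j k, 0 ≤ W s j k) (hW : ∀ s j, HasSum (W s j) (w s j))
    (hWa : ∀ s j, Tendsto (fun k => W s j k / q k) atTop (𝓝 (a s j)))
    (hann : ∀ s j, 0 ≤ a s j)
    (hvnn : ∀ j, 0 ≤ v j) (hv : ∀ j, v j = 1 + ∑ s, v s * w s j)
    {y : ℕ → ι → ℕ → ℝ} {z : ι → ℕ → ℝ} (hynn : ∀ N s k, 0 ≤ y N s k)
    (hyz : ∀ N s k, y N s k ≤ z s k) (hy0 : ∀ s k, y 0 s k = 0)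
    (hy : ∀ N j k, 1 ≤ k → y (N + 1) j k = ∑ s, conv (y N s) (W s j) k) :
    ∃ m : ℝ, 0 ≤ m ∧ ∀ᶠ k in atTop, ∀ N s, y N s k ≤ m * v s * q k := by
  have hznn : ∀ s k, 0 ≤ z s k := fun s k => (hynn 0 s k).trans (hyz 0 s k)
  have hwnn : ∀ s j, 0 ≤ w s j := fun s j => (hW s j).nonneg (hWnn s j)
  have hv1 : ∀ j, 1 ≤ v j := fun j => by
    rw [hv j]
    have : 0 ≤ ∑ s, v s * w s j := Finset.sum_nonneg fun s _ => mul_nonneg (hvnn s) (hwnn s j)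
    linarith
  obtain ⟨A, hAmid, hAq⟩ : ∃ A : ℕ,
      (∀ j, ∀ᶠ k in atTop, (∑ s, v s * (a s j + 1)) * midConv A q q k ≤ 1 / 4 * q k) ∧
      ∀ k, A ≤ k → 0 < q k ∧ ∀ s j, W s j k ≤ (a s j + 1) * q k := by
    refine Eventually.exists (f := atTop) (Eventually.and ?_ ?_)
    · exact eventually_all.2 fun j =>
        hq.eventually_mul_midConv_le hqsum (∑ s, v s * (a s j + 1)) (by norm_num)
    · exact eventually_forall_ge_atTop.2 (hq.1.and (eventually_all.2 fun s =>
        eventually_all.2 fun j => hq.eventually_le_of_tendsto_div (hWa s j) (lt_add_one _)))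
  have hhead : ∀ j, ∀ᶠ k in atTop,
      (∑ s, v s * ∑ l ∈ Finset.range A, q (k - l) * W s j l) ≤ (v j - 3 / 4) * q k := by
    intro j
    refine hq.eventually_le_of_tendsto_div
      (a := ∑ s, v s * (1 * ∑ l ∈ Finset.range A, W s j l)) ?_ ?_
    · simp only [Finset.sum_div, mul_div_assoc]
      refine tendsto_finsetSum _ fun s _ => Tendsto.const_mul _ ?_
      simpa only [Finset.sum_div, mul_div_assoc] using
        hq.tendsto_head_div hq.tendsto_div_self (W s j) A
    · have : ∑ s, v s * (1 * ∑ l ∈ Finset.range A, W s j l) ≤ ∑ s, v s * w s j :=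
        Finset.sum_le_sum fun s _ => mul_le_mul_of_nonneg_left
          (by rw [one_mul]; exact sum_le_hasSum _ (fun l _ => hWnn s j l) (hW s j)) (hvnn s)
      linarith [hv j]
  set B : ι → ℝ := fun j => ∑ s, a s j * ∑ l ∈ Finset.range A, z s l with hB
  have hBnn : ∀ j, 0 ≤ B j := fun j => Finset.sum_nonneg fun s _ =>
    mul_nonneg (hann s j) (Finset.sum_nonneg fun l _ => hznn s l)
  have htail : ∀ j, ∀ᶠ k in atTop,
      (∑ s, ∑ l ∈ Finset.range A, z s l * W s j (k - l)) ≤ (B j + 1) * q k := by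
    intro j
    refine hq.eventually_le_of_tendsto_div (a := B j) ?_ (lt_add_one _)
    simp only [Finset.sum_div _ _ (q _)]
    refine tendsto_finsetSum _ fun s _ => ?_
    simpa only [Finset.sum_div] using hq.tendsto_head_div' (hWa s j) (z s) A
  obtain ⟨K, hK⟩ := eventually_atTop.1 ((eventually_all.2 hAmid).and
    ((eventually_all.2 hhead).and ((eventually_all.2 htail).and
      (eventually_ge_atTop (2 * A + 1)))))
  set m : ℝ := 2 * ∑ j, (B j + 1) + ∑ j, ∑ k ∈ Finset.Ico A K, z j k / q k with hm
  have hBsum : 0 ≤ ∑ j, (B j + 1) := Finset.sum_nonneg fun j _ => by linarith [hBnn j]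
  have hzq : ∀ j k, 0 ≤ z j k / q k := fun j k => div_nonneg (hznn j k) (hqnn k)
  have hzsum : 0 ≤ ∑ j, ∑ k ∈ Finset.Ico A K, z j k / q k :=
    Finset.sum_nonneg fun j _ => Finset.sum_nonneg fun k _ => hzq j k
  have hm0 : 0 ≤ m := by linarith
  have hmB : ∀ j, 2 * (B j + 1) ≤ m := fun j => by
    have := Finset.single_le_sum (f := fun j => B j + 1)
      (fun j _ => by linarith [hBnn j]) (Finset.mem_univ j)
    linarith
  have hmz : ∀ j k, A ≤ k → k < K → z j k ≤ m * q k := fun j k hAk hkK => by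
    rw [← div_le_iff₀ (hAq k hAk).1]
    have h1 := Finset.single_le_sum (f := fun k => z j k / q k)
      (fun k _ => hzq j k) (Finset.mem_Ico.2 ⟨hAk, hkK⟩)
    have h2 := Finset.single_le_sum (f := fun j => ∑ k ∈ Finset.Ico A K, z j k / q k)
      (fun j _ => Finset.sum_nonneg fun k _ => hzq j k) (Finset.mem_univ j)
    linarith
  refine ⟨m, hm0, eventually_atTop.2 ⟨A, fun k hAk N => ?_⟩⟩
  induction N generalizing k with
  | zero =>
    intro s
    rw [hy0]
    exact mul_nonneg (mul_nonneg hm0 (hvnn s)) (hqnn k)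
  | succ N ih =>
    intro j
    rcases lt_or_ge k K with hkK | hkK
    · calc y (N + 1) j k ≤ z j k := hyz _ _ _
        _ ≤ m * 1 * q k := by rw [mul_one]; exact hmz j k hAk hkK
        _ ≤ m * v j * q k := by gcongr; exacts [hqnn k, hv1 j]
    obtain ⟨hmid, hhd, htl, hk⟩ := hK k hkK
    have hqk := hqnn k
    have h1 : ∑ s, ∑ l ∈ Finset.range A, y N s (k - l) * W s j l
        ≤ m * ∑ s, v s * ∑ l ∈ Finset.range A, q (k - l) * W s j l := by
      simp only [Finset.mul_sum]
      refine Finset.sum_le_sum fun s _ => Finset.sum_le_sum fun l hl => ?_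
      rw [Finset.mem_range] at hl
      calc _ ≤ m * v s * q (k - l) * W s j l :=
            mul_le_mul_of_nonneg_right (ih _ (by omega) s) (hWnn s j l)
        _ = _ := by ring
    have h2 : ∑ s, ∑ l ∈ Finset.range A, y N s l * W s j (k - l)
        ≤ ∑ s, ∑ l ∈ Finset.range A, z s l * W s j (k - l) :=
      Finset.sum_le_sum fun s _ => Finset.sum_le_sum fun l _ =>
        mul_le_mul_of_nonneg_right (hyz _ _ _) (hWnn _ _ _)
    have h3 : ∑ s, midConv A (y N s) (W s j) k
        ≤ m * ((∑ s, v s * (a s j + 1)) * midConv A q q k) := by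
      rw [Finset.sum_mul, Finset.mul_sum]
      refine Finset.sum_le_sum fun s _ => ?_
      calc _ ≤ midConv A (fun k => m * v s * q k) (fun k => (a s j + 1) * q k) k :=
            midConv_le_of_le (hWnn s j)
              (fun k => mul_nonneg (mul_nonneg hm0 (hvnn s)) (hqnn k))
              (fun k hk => ih k hk s) (fun k hk => (hAq k hk).2 s j) k
        _ = _ := by rw [midConv_const_mul]; ring
    have h4 := mul_le_mul_of_nonneg_left (hhd j) hm0
    have h5 := mul_le_mul_of_nonneg_left (hmid j) hm0
    have h6 := mul_le_mul_of_nonneg_right (hmB j) hqk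
    rw [hy N j k (by omega), Finset.sum_congr rfl fun s _ =>
      conv_eq_heads_add_midConv (y N s) (W s j) (show 2 * A ≤ k + 1 by omega),
      Finset.sum_add_distrib, Finset.sum_add_distrib]
    linarith [htl j]

/-- One contraction step for the deviation of a dominated renewal solution from its limit. -/
theorem eventually_abs_sub_le_of_renewal (hq : SLocOne q) (hqnn : ∀ k, 0 ≤ q k)
    (hqsum : HasSum q 1) (hWnn : ∀ s j k, 0 ≤ W s j k) (hW : ∀ s j, HasSum (W s j) (w s j))
    (hWa : ∀ s j, Tendsto (fun k => W s j k / q k) atTop (𝓝 (a s j)))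
    {x : ι → ℕ → ℝ} {r b L u : ι → ℝ} (hxnn : ∀ s k, 0 ≤ x s k)
    (hxr : ∀ s, HasSum (x s) (r s)) (hbnn : ∀ s, 0 ≤ b s)
    (hxb : ∀ᶠ k in atTop, ∀ s, x s k ≤ b s * q k)
    (hx : ∀ j k, 1 ≤ k → x j k = ∑ s, conv (x s) (W s j) k)
    (hL : ∀ j, L j = ∑ s, a s j * r s + ∑ s, L s * w s j)
    (hunn : ∀ s, 0 ≤ u s) (hu : ∀ᶠ k in atTop, ∀ s, |x s k - L s * q k| ≤ u s * q k)
    {ε : ℝ} (hε : 0 < ε) (j : ι) :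
    ∀ᶠ k in atTop, |x j k - L j * q k| ≤ (∑ s, u s * w s j + ε) * q k := by
  have hlim : Tendsto (fun A => (∑ s, a s j * ∑ l ∈ Finset.range A, x s l)
      + ∑ s, L s * ∑ l ∈ Finset.range A, W s j l) atTop (𝓝 (L j)) := by
    rw [hL j]
    exact (tendsto_finsetSum _ fun s _ => (hxr s).tendsto_sum_nat.const_mul _).add
      (tendsto_finsetSum _ fun s _ => (hW s j).tendsto_sum_nat.const_mul _)
  obtain ⟨A, hAmid, hAb, hAlim⟩ := ((hq.eventually_mul_midConv_le hqsum
    (∑ s, b s * (a s j + 1)) (show 0 < ε / 3 by positivity)).and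
    ((eventually_forall_ge_atTop.2 (hxb.and (eventually_all.2 fun s =>
        hq.eventually_le_of_tendsto_div (hWa s j) (lt_add_one _)))).and
      (hlim.eventually (Metric.ball_mem_nhds _ (show 0 < ε / 3 by positivity))))).exists
  set T : ℕ → ℝ := fun k => (∑ s, ∑ l ∈ Finset.range A, x s l * W s j (k - l))
    + ∑ s, L s * ∑ l ∈ Finset.range A, q (k - l) * W s j l with hT
  have hTlim : Tendsto (fun k => T k / q k) atTop
      (𝓝 ((∑ s, a s j * ∑ l ∈ Finset.range A, x s l)
        + ∑ s, L s * (1 * ∑ l ∈ Finset.range A, W s j l))) := by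
    simp only [hT, add_div, Finset.sum_div _ _ (q _), mul_div_assoc]
    refine (tendsto_finsetSum _ fun s _ => ?_).add
      (tendsto_finsetSum _ fun s _ => Tendsto.const_mul _ ?_)
    · simpa only [Finset.sum_div, mul_div_assoc] using hq.tendsto_head_div' (hWa s j) (x s) A
    · simpa only [Finset.sum_div, mul_div_assoc] using
        hq.tendsto_head_div hq.tendsto_div_self (W s j) A
  simp only [one_mul] at hTlim
  have hTle : ∀ᶠ k in atTop, |T k - L j * q k| ≤ ε / 3 * q k := by
    filter_upwards [hq.1, hTlim.eventually (Metric.isOpen_ball.mem_nhds hAlim)] with k hk h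
    rw [Real.dist_eq] at h
    rw [show T k - L j * q k = (T k / q k - L j) * q k by field_simp, abs_mul,
      abs_of_pos hk]
    exact mul_le_mul_of_nonneg_right h.le hk.le
  have hhead : ∀ᶠ k in atTop,
      (∑ s, u s * ∑ l ∈ Finset.range A, q (k - l) * W s j l)
        ≤ (∑ s, u s * w s j + ε / 3) * q k := by
    refine hq.eventually_le_of_tendsto_div
      (a := ∑ s, u s * (1 * ∑ l ∈ Finset.range A, W s j l)) ?_ ?_
    · simp only [Finset.sum_div, mul_div_assoc]
      refine tendsto_finsetSum _ fun s _ => Tendsto.const_mul _ ?_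
      simpa only [Finset.sum_div, mul_div_assoc] using
        hq.tendsto_head_div hq.tendsto_div_self (W s j) A
    · have : ∑ s, u s * (1 * ∑ l ∈ Finset.range A, W s j l) ≤ ∑ s, u s * w s j :=
        Finset.sum_le_sum fun s _ => mul_le_mul_of_nonneg_left
          (by rw [one_mul]; exact sum_le_hasSum _ (fun l _ => hWnn s j l) (hW s j)) (hunn s)
      linarith
  obtain ⟨K, hK⟩ := eventually_atTop.1 hu
  filter_upwards [hAmid, hTle, hhead, eventually_ge_atTop (2 * A + 1 + K)] with k hmid hTk hhd hk
  have hdecomp : x j k - L j * q k = (T k - L j * q k)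
      + (∑ s, ∑ l ∈ Finset.range A, (x s (k - l) - L s * q (k - l)) * W s j l)
      + ∑ s, midConv A (x s) (W s j) k := by
    have : ∑ s, ∑ l ∈ Finset.range A, (x s (k - l) - L s * q (k - l)) * W s j l
        = (∑ s, ∑ l ∈ Finset.range A, x s (k - l) * W s j l)
          - ∑ s, L s * ∑ l ∈ Finset.range A, q (k - l) * W s j l := by
      simp only [Finset.mul_sum, ← Finset.sum_sub_distrib]
      exact Finset.sum_congr rfl fun s _ => Finset.sum_congr rfl fun l _ => by ring
    rw [this, hx j k (by omega), Finset.sum_congr rfl fun s _ =>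
      conv_eq_heads_add_midConv (x s) (W s j) (show 2 * A ≤ k + 1 by omega),
      Finset.sum_add_distrib, Finset.sum_add_distrib]
    simp only [hT]
    ring
  have h2 : |∑ s, ∑ l ∈ Finset.range A, (x s (k - l) - L s * q (k - l)) * W s j l|
      ≤ ∑ s, u s * ∑ l ∈ Finset.range A, q (k - l) * W s j l := by
    refine (Finset.abs_sum_le_sum_abs _ _).trans (Finset.sum_le_sum fun s _ => ?_)
    rw [Finset.mul_sum]
    refine (Finset.abs_sum_le_sum_abs _ _).trans (Finset.sum_le_sum fun l hl => ?_)
    rw [Finset.mem_range] at hl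
    rw [abs_mul, abs_of_nonneg (hWnn s j l), ← mul_assoc]
    exact mul_le_mul_of_nonneg_right (hK _ (by omega) s) (hWnn s j l)
  have h3 : ∑ s, midConv A (x s) (W s j) k
      ≤ (∑ s, b s * (a s j + 1)) * midConv A q q k := by
    rw [Finset.sum_mul]
    refine Finset.sum_le_sum fun s _ => ?_
    rw [← midConv_const_mul]
    exact midConv_le_of_le (hWnn s j) (fun k => mul_nonneg (hbnn s) (hqnn k))
      (fun k hk => (hAb k hk).1 s) (fun k hk => (hAb k hk).2 s) k
  have h4 : 0 ≤ ∑ s, midConv A (x s) (W s j) k :=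
    Finset.sum_nonneg fun s _ => midConv_nonneg (hxnn s) (hWnn s j) A k
  rw [hdecomp]
  refine (abs_add_three _ _ _).trans ?_
  rw [abs_of_nonneg h4]
  linarith

/-- Asymptotics of a dominated solution of a defective renewal equation. -/
theorem tendsto_div_of_renewal (hq : SLocOne q) (hqnn : ∀ k, 0 ≤ q k)
    (hqsum : HasSum q 1) (hWnn : ∀ s j k, 0 ≤ W s j k) (hW : ∀ s j, HasSum (W s j) (w s j))
    (hWa : ∀ s j, Tendsto (fun k => W s j k / q k) atTop (𝓝 (a s j)))
    (hvnn : ∀ j, 0 ≤ v j) (hv : ∀ j, v j = 1 + ∑ s, v s * w s j)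
    {x : ι → ℕ → ℝ} {r b L : ι → ℝ} (hxnn : ∀ s k, 0 ≤ x s k)
    (hxr : ∀ s, HasSum (x s) (r s)) (hbnn : ∀ s, 0 ≤ b s)
    (hxb : ∀ᶠ k in atTop, ∀ s, x s k ≤ b s * q k)
    (hx : ∀ j k, 1 ≤ k → x j k = ∑ s, conv (x s) (W s j) k)
    (hL : ∀ j, L j = ∑ s, a s j * r s + ∑ s, L s * w s j) (i : ι) :
    Tendsto (fun k => x i k / q k) atTop (𝓝 (L i)) := by
  have hwnn : ∀ s j, 0 ≤ w s j := fun s j => (hW s j).nonneg (hWnn s j)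
  have hv1 : ∀ j, 1 ≤ v j := fun j => by
    rw [hv j]
    have : 0 ≤ ∑ s, v s * w s j := Finset.sum_nonneg fun s _ => mul_nonneg (hvnn s) (hwnn s j)
    linarith
  set V : ℝ := ∑ s, v s with hV
  have hvV : ∀ j, v j ≤ V := fun j =>
    Finset.single_le_sum (f := v) (fun s _ => hvnn s) (Finset.mem_univ j)
  have hV1 : 1 ≤ V := (hv1 i).trans (hvV i)
  set θ : ℝ := 1 - 1 / (2 * V) with hθ
  have hθ1 : θ < 1 := by
    have : 0 < 1 / (2 * V) := by positivity
    linarith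
  have hθ0 : 0 < θ := by
    have : 1 / (2 * V) ≤ 1 / 2 := one_div_le_one_div_of_le (by norm_num) (by linarith)
    linarith
  set c : ℝ := 1 + ∑ s, (b s + |L s|) with hc
  have hterm : ∀ s, 0 ≤ b s + |L s| := fun s => add_nonneg (hbnn s) (abs_nonneg _)
  have hc0 : 0 < c := by
    have : 0 ≤ ∑ s, (b s + |L s|) := Finset.sum_nonneg fun s _ => hterm s
    linarith
  have hgeom : ∀ n : ℕ, ∀ᶠ k in atTop, ∀ s, |x s k - L s * q k| ≤ c * θ ^ n * v s * q k := by
    intro n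
    induction n with
    | zero =>
      filter_upwards [hxb] with k hk s
      have h1 : |x s k - L s * q k| ≤ (b s + |L s|) * q k := by
        refine (abs_sub _ _).trans ?_
        rw [abs_mul, abs_of_nonneg (hxnn s k), abs_of_nonneg (hqnn k), add_mul]
        linarith [hk s]
      have h2 : b s + |L s| ≤ c := by
        have := Finset.single_le_sum (f := fun s => b s + |L s|)
          (fun s _ => hterm s) (Finset.mem_univ s)
        linarith
      refine h1.trans (mul_le_mul_of_nonneg_right ?_ (hqnn k))
      rw [pow_zero, mul_one]
      nlinarith [hv1 s]
    | succ n ih =>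
      refine eventually_all.2 fun j => ?_
      have hcn : 0 < c * θ ^ n := by positivity
      filter_upwards [eventually_abs_sub_le_of_renewal hq hqnn hqsum hWnn hW hWa hxnn hxr hbnn
        hxb hx hL (u := fun s => c * θ ^ n * v s) (fun s => mul_nonneg hcn.le (hvnn s)) ih
        (half_pos hcn) j] with k hk
      refine hk.trans (mul_le_mul_of_nonneg_right ?_ (hqnn k))
      have h1 : ∑ s, c * θ ^ n * v s * w s j = c * θ ^ n * (v j - 1) := by
        rw [hv j, add_sub_cancel_left, Finset.mul_sum]
        exact Finset.sum_congr rfl fun s _ => by ring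
      have h2 : v j - 1 / 2 ≤ θ * v j := by
        have : 1 / (2 * V) * v j ≤ 1 / 2 := by
          rw [div_mul_eq_mul_div, one_mul, div_le_iff₀ (by positivity)]
          linarith [hvV j]
        rw [hθ]
        linarith
      rw [h1]
      calc c * θ ^ n * (v j - 1) + c * θ ^ n / 2 = c * θ ^ n * (v j - 1 / 2) := by ring
        _ ≤ c * θ ^ n * (θ * v j) := mul_le_mul_of_nonneg_left h2 hcn.le
        _ = c * θ ^ (n + 1) * v j := by ring
  rw [Metric.tendsto_nhds]
  intro ε hε
  have hz : Tendsto (fun n : ℕ => c * θ ^ n * v i) atTop (𝓝 0) := by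
    simpa using ((tendsto_pow_atTop_nhds_zero_of_lt_one hθ0.le hθ1).const_mul c).mul_const (v i)
  obtain ⟨n, hn⟩ := (hz.eventually (gt_mem_nhds hε)).exists
  filter_upwards [hgeom n, hq.1] with k hk hqk
  rw [Real.dist_eq, show x i k / q k - L i = (x i k - L i * q k) / q k by field_simp, abs_div,
    abs_of_pos hqk]
  exact ((div_le_iff₀ hqk).2 (hk i)).trans_lt hn

end Renewal

section MatrixConvolution

variable {M : ℕ} {W : ℕ → Matrix (Fin M) (Fin M) ℝ}

theorem mconvPow_succ_apply (W : ℕ → Matrix (Fin M) (Fin M) ℝ) (n k : ℕ) (i j : Fin M) :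
    mconvPow W (n + 1) k i j
      = ∑ s, conv (fun l => mconvPow W n l i s) (fun l => W l s j) k := by
  simp only [mconvPow, conv, Matrix.sum_apply, Matrix.mul_apply]
  exact Finset.sum_comm

theorem mconvPow_nonneg (hW : ∀ k i j, 0 ≤ W k i j) (n k : ℕ) (i j : Fin M) :
    0 ≤ mconvPow W n k i j := by
  induction n generalizing k i j with
  | zero =>
    simp only [mconvPow]
    split_ifs
    · rw [Matrix.one_apply]
      split_ifs <;> norm_num
    · simp
  | succ n ih =>
    rw [mconvPow_succ_apply]
    exact Finset.sum_nonneg fun s _ => Finset.sum_nonneg fun l _ => mul_nonneg (ih _ _ _) (hW _ _ _)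

theorem HasSum.conv {f g : ℕ → ℝ} {a b : ℝ} (hf : HasSum f a) (hg : HasSum g b)
    (hfnn : ∀ k, 0 ≤ f k) (hgnn : ∀ k, 0 ≤ g k) : HasSum (conv f g) (a * b) := by
  have hf' : Summable fun k => ‖f k‖ := by
    simpa only [Real.norm_of_nonneg (hfnn _)] using hf.summable
  have hg' : Summable fun k => ‖g k‖ := by
    simpa only [Real.norm_of_nonneg (hgnn _)] using hg.summable
  have h1 := tsum_mul_tsum_eq_tsum_sum_range_of_summable_norm hg' hf'
  have h2 := (summable_norm_sum_mul_range_of_summable_norm hg' hf').of_norm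
  have h3 : _root_.conv f g = fun k => ∑ l ∈ Finset.range (k + 1), g l * f (k - l) := by
    funext k
    simp only [_root_.conv, mul_comm]
  rw [h3, mul_comm, ← hf.tsum_eq, ← hg.tsum_eq, h1]
  exact h2.hasSum

theorem hasSum_mconvPow (hW : ∀ k i j, 0 ≤ W k i j) {Ws : Matrix (Fin M) (Fin M) ℝ}
    (hWs : ∀ i j, HasSum (fun k => W k i j) (Ws i j)) (n : ℕ) (i j : Fin M) :
    HasSum (fun k => mconvPow W n k i j) ((Ws ^ n) i j) := by
  induction n generalizing i j with
  | zero =>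
    have h := hasSum_ite_eq (0 : ℕ) ((1 : Matrix (Fin M) (Fin M) ℝ) i j)
    rw [pow_zero]
    refine h.congr_fun ?_
    intro k
    simp only [mconvPow]
    split_ifs <;> rfl
  | succ n ih =>
    simp only [mconvPow_succ_apply]
    rw [pow_succ, Matrix.mul_apply]
    exact hasSum_sum fun s _ => (ih i s).conv (hWs s j)
      (fun k => mconvPow_nonneg hW n k i s) (fun k => hW k s j)

end MatrixConvolution

/-- Matrix geometric-sum asymptotics for locally subexponential increments
(Proposition A.8 of the paper). -/
theorem stmt6 (M : ℕ) (W : ℕ → Matrix (Fin M) (Fin M) ℝ)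
    (hWnn : ∀ k i j, 0 ≤ W k i j)
    (hWsum : ∀ i j, Summable fun k => W k i j)
    (Ws : Matrix (Fin M) (Fin M) ℝ) (hWs : Ws = Matrix.of fun i j => ∑' k, W k i j)
    (hgeo : ∀ i j, Summable fun n : ℕ => (Ws ^ n) i j)
    (hinv : ∀ i j, (∑' n : ℕ, (Ws ^ n) i j) = (1 - Ws)⁻¹ i j)
    (pU : ℕ → ℝ) (hUnn : ∀ k, 0 ≤ pU k) (hUsum : HasSum pU 1) (hU : SLocOne pU)
    (Wt : Matrix (Fin M) (Fin M) ℝ) (hWtnn : ∀ i j, 0 ≤ Wt i j)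
    (hWl : ∀ i j, Tendsto (fun k => W k i j / pU k) atTop (nhds (Wt i j))) :
    ∀ i j, Tendsto (fun k => (∑' n : ℕ, mconvPow W n k i j) / pU k) atTop
      (nhds (((1 - Ws)⁻¹ * Wt * (1 - Ws)⁻¹) i j)) := by
  have hWH : ∀ i j, HasSum (fun k => W k i j) (Ws i j) := fun i j => by
    rw [hWs]
    exact (hWsum i j).hasSum
  set R : Matrix (Fin M) (Fin M) ℝ := (1 - Ws)⁻¹ with hR
  have hRsum : ∀ i j, HasSum (fun n : ℕ => (Ws ^ n) i j) (R i j) := fun i j => by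
    rw [← hinv i j]
    exact (hgeo i j).hasSum
  have hRrec : R = 1 + R * Ws := by
    ext i j
    have h1 : HasSum (fun n : ℕ => (Ws ^ (n + 1)) i j) ((R * Ws) i j) := by
      simp only [pow_succ, Matrix.mul_apply]
      exact hasSum_sum fun s _ => (hRsum i s).mul_right _
    have h2 := (hasSum_nat_add_iff' (f := fun n : ℕ => (Ws ^ n) i j) 1).2 (hRsum i j)
    have h3 := h1.unique h2
    simp only [Finset.sum_range_one, pow_zero] at h3
    rw [Matrix.add_apply, h3]
    ring
  have hnn := mconvPow_nonneg hWnn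
  have hpow := hasSum_mconvPow hWnn hWH
  have hsum : ∀ i j k, Summable fun n => mconvPow W n k i j := fun i j k =>
    (hgeo i j).of_nonneg_of_le (fun n => hnn n k i j)
      (fun n => le_hasSum (hpow n i j) k fun l _ => hnn n l i j)
  have hGnn : ∀ i j k, 0 ≤ ∑' n, mconvPow W n k i j := fun i j k =>
    tsum_nonneg fun n => hnn n k i j
  have hRnn : ∀ i j, 0 ≤ R i j := fun i j =>
    (hRsum i j).nonneg fun n => (hpow n i j).nonneg fun k => hnn n k i j
  have hGsum : ∀ i j, HasSum (fun k => ∑' n, mconvPow W n k i j) (R i j) := fun i j => by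
    have hprod : Summable fun p : ℕ × ℕ => mconvPow W p.1 p.2 i j := by
      rw [summable_prod_of_nonneg fun p => hnn p.1 p.2 i j]
      refine ⟨fun n => (hpow n i j).summable, ?_⟩
      simpa only [(hpow _ i j).tsum_eq] using hgeo i j
    have h1 : ∑' p : ℕ × ℕ, mconvPow W p.1 p.2 i j = R i j := by
      rw [hprod.tsum_prod, ← (hRsum i j).tsum_eq]
      exact tsum_congr fun n => (hpow n i j).tsum_eq
    have h2 : HasSum (fun p : ℕ × ℕ => mconvPow W p.2 p.1 i j) (R i j) := by
      rw [← h1]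
      exact (Equiv.prodComm ℕ ℕ).hasSum_iff.2 hprod.hasSum
    exact h2.prod_fiberwise fun k => (hsum i j k).hasSum
  intro i j
  have hvnn : ∀ j, 0 ≤ ∑ s, R s j := fun j => Finset.sum_nonneg fun s _ => hRnn s j
  have hv : ∀ j, ∑ s, R s j = 1 + ∑ s, (∑ t, R t s) * Ws s j := fun j => by
    calc ∑ t, R t j = ∑ t, (1 + R * Ws) t j := by rw [← hRrec]
      _ = 1 + ∑ t, ∑ s, R t s * Ws s j := by
        simp [Matrix.add_apply, Finset.sum_add_distrib, Matrix.one_apply, Matrix.mul_apply]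
      _ = _ := by
        rw [Finset.sum_comm]
        simp only [Finset.sum_mul]
  have hzero : ∀ j k, 1 ≤ k → mconvPow W 0 k i j = 0 := fun j k hk => by
    simp [mconvPow, show k ≠ 0 by omega]
  obtain ⟨m, hm0, hm⟩ := exists_bound_of_renewal_iterates (W := fun s j k => W k s j)
    (w := fun s j => Ws s j) (a := fun s j => Wt s j) (v := fun j => ∑ s, R s j)
    (y := fun N s k => ∑ n ∈ Finset.range N, mconvPow W n k i s)
    (z := fun s k => ∑' n, mconvPow W n k i s)
    hU hUnn hUsum (fun s j k => hWnn k s j) hWH hWl hWtnn hvnn hv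
    (fun N s k => Finset.sum_nonneg fun n _ => hnn n k i s)
    (fun N s k => (hsum i s k).sum_le_tsum _ fun n _ => hnn n k i s)
    (fun s k => by simp)
    (fun N j k hk => by
      rw [Finset.sum_range_succ', hzero j k hk, add_zero]
      simp only [mconvPow_succ_apply, conv, Finset.sum_mul]
      rw [Finset.sum_comm]
      exact Finset.sum_congr rfl fun s _ => Finset.sum_comm)
  refine tendsto_div_of_renewal (W := fun s j k => W k s j)
    (w := fun s j => Ws s j) (a := fun s j => Wt s j) (v := fun j => ∑ s, R s j)
    (x := fun s k => ∑' n, mconvPow W n k i s) (r := fun s => R i s)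
    (b := fun s => m * ∑ t, R t s) (L := fun s => (R * Wt * R) i s)
    hU hUnn hUsum (fun s j k => hWnn k s j) hWH hWl hvnn hv (fun s k => hGnn i s k)
    (fun s => hGsum i s) (fun s => mul_nonneg hm0 (hvnn s)) ?_ ?_ ?_ j
  · filter_upwards [hm] with k hk s
    exact le_of_tendsto' (hsum i s k).hasSum.tendsto_sum_nat fun N => hk N s
  · intro j k hk
    rw [(hsum i j k).tsum_eq_zero_add, hzero j k hk, zero_add]
    simp only [mconvPow_succ_apply, conv]
    refine HasSum.tsum_eq (hasSum_sum fun s _ => hasSum_sum fun l _ => ?_)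
    exact (hsum i s (k - l)).hasSum.mul_right _
  · intro j
    have h : R * Wt * R = R * Wt + R * Wt * R * Ws := by
      calc R * Wt * R = R * Wt * (1 + R * Ws) := by rw [← hRrec]
        _ = _ := by rw [mul_add, mul_one, ← mul_assoc]
    calc (R * Wt * R) i j = (R * Wt + R * Wt * R * Ws) i j := by rw [← h]
      _ = _ := by
        rw [Matrix.add_apply, Matrix.mul_apply, Matrix.mul_apply (N := Ws)]
        simp only [mul_comm]
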